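/- For every Λ ∈ L^H and all Hermitian directions δΛ₁, δΛ₂, the second directional (Gâteaux) derivative of J_Ψ at Λ exists and equals δ²J_Ψ(Λ; δΛ₁, δΛ₂) = tr ∫ Ψ Q_Λ^{-1} G* δΛ₂ G Q_Λ^{-1} G* δΛ₁ G Q_Λ^{-1} + tr ∫ Ψ Q_Λ^{-1} G* δΛ₁ G Q_Λ^{-1} G* δΛ₂ G Q_Λ^{-1}. -/

import Mathlib

open Matrix MeasureTheory
open scoped ComplexOrder

/-- Entrywise integral over the unit circle, `∫_{-π}^{π} F(e^{jθ}) dθ/2π`. -/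
noncomputable def circleIntM {n m : ℕ} (F : ℝ → Matrix (Fin n) (Fin m) ℂ) :
    Matrix (Fin n) (Fin m) ℂ :=
  Matrix.of fun i j => (2 * (Real.pi : ℂ))⁻¹ * ∫ θ in (-Real.pi)..Real.pi, F θ i j

/-- The transfer function `G(z) = (zI - A)⁻¹ B` evaluated at `z = e^{jθ}`. -/
noncomputable def Gfun {n m : ℕ} (A : Matrix (Fin n) (Fin n) ℂ)
    (B : Matrix (Fin n) (Fin m) ℂ) (θ : ℝ) : Matrix (Fin n) (Fin m) ℂ :=
  (Complex.exp (θ * Complex.I) • (1 : Matrix (Fin n) (Fin n) ℂ) - A)⁻¹ * B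

/-- The pair `(A, B)` is reachable: the controllability matrix
`[B, AB, ..., A^{n-1}B]` has rank `n`. -/
noncomputable def IsReachable {n m : ℕ} (A : Matrix (Fin n) (Fin n) ℂ)
    (B : Matrix (Fin n) (Fin m) ℂ) : Prop :=
  (Matrix.of fun (i : Fin n) (p : Fin n × Fin m) => (A ^ (p.1 : ℕ) * B) i p.2).rank = n

/-- `Q_Λ(e^{jθ}) = I + G(e^{jθ})* Λ G(e^{jθ})`. -/
noncomputable def Qfun {n m : ℕ} (A : Matrix (Fin n) (Fin n) ℂ)
    (B : Matrix (Fin n) (Fin m) ℂ) (Λ : Matrix (Fin n) (Fin n) ℂ) (θ : ℝ) :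
    Matrix (Fin m) (Fin m) ℂ :=
  (1 : Matrix (Fin m) (Fin m) ℂ) + (Gfun A B θ)ᴴ * Λ * Gfun A B θ

/-- The dual functional `J_Ψ(Λ) = tr ∫ Q_Λ⁻¹ Ψ + tr Λ` (a real number). -/
noncomputable def Jfun {n m : ℕ} (A : Matrix (Fin n) (Fin n) ℂ)
    (B : Matrix (Fin n) (Fin m) ℂ) (Ψ : ℝ → Matrix (Fin m) (Fin m) ℂ)
    (Λ : Matrix (Fin n) (Fin n) ℂ) : ℝ :=
  ((circleIntM fun θ => (Qfun A B Λ θ)⁻¹ * Ψ θ).trace + Λ.trace).re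

theorem ContinuousOn.matrix_inv {X : Type*} [TopologicalSpace X] {n : Type*} [Fintype n]
    [DecidableEq n] {f : X → Matrix n n ℂ} {s : Set X} (hf : ContinuousOn f s)
    (h : ∀ x ∈ s, (f x).det ≠ 0) : ContinuousOn (fun x => (f x)⁻¹) s := by
  rw [continuousOn_iff_continuous_domRestrict] at hf ⊢
  have h' : (s.domRestrict fun x => (f x)⁻¹)
      = fun x => (s.domRestrict f x).det⁻¹ • (s.domRestrict f x).adjugate := by
    funext x
    simp [Matrix.inv_def, Set.domRestrict_apply, Ring.inverse_eq_inv']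
  rw [h']
  exact (hf.matrix_det.inv₀ fun x => h x x.2).smul hf.matrix_adjugate

theorem continuous_Gfun {n m : ℕ} (A : Matrix (Fin n) (Fin n) ℂ) (B : Matrix (Fin n) (Fin m) ℂ)
    (hA : ∀ z ∈ spectrum ℂ A, ‖z‖ < 1) : Continuous (Gfun A B) := by
  unfold Gfun
  refine Continuous.matrix_mul ?_ continuous_const
  rw [← continuousOn_univ]
  refine ContinuousOn.matrix_inv ?_ fun θ _ => ?_
  · exact Continuous.continuousOn (by fun_prop)
  · have h : Complex.exp (θ * Complex.I) ∉ spectrum ℂ A := fun hz => by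
      simpa [Complex.norm_exp_ofReal_mul_I] using hA _ hz
    rw [spectrum.notMem_iff, Algebra.algebraMap_eq_smul_one, Matrix.isUnit_iff_isUnit_det] at h
    exact h.ne_zero

/-- Differentiation under the integral sign for an integrand with jointly continuous
derivative. -/
theorem hasDerivAt_intervalIntegral_of_continuousOn {f f' : ℝ → ℝ → ℂ} {U : Set ℝ} {x₀ a b : ℝ}
    (hU : U ∈ nhds x₀) (hf : ∀ x ∈ U, ContinuousOn (f x) (Set.uIcc a b))
    (hf' : ContinuousOn (Function.uncurry f') (U ×ˢ Set.uIcc a b))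
    (hd : ∀ x ∈ U, ∀ θ ∈ Set.uIcc a b, HasDerivAt (fun y => f y θ) (f' x θ) x) :
    HasDerivAt (fun x => ∫ θ in a..b, f x θ) (∫ θ in a..b, f' x₀ θ) x₀ := by
  obtain ⟨ε, hε, hK⟩ := Metric.nhds_basis_closedBall.mem_iff.1 hU
  obtain ⟨C, hC⟩ := ((isCompact_closedBall x₀ ε).prod
    (isCompact_uIcc (a := a) (b := b))).exists_bound_of_continuousOn
      (hf'.mono (Set.prod_mono hK subset_rfl))
  have hmeas : ∀ g : ℝ → ℂ, ContinuousOn g (Set.uIcc a b) →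
      AEStronglyMeasurable g (volume.restrict (Set.uIoc a b)) := fun g hg =>
    (hg.mono Set.uIoc_subset_uIcc).aestronglyMeasurable measurableSet_uIoc
  have hx₀ : x₀ ∈ U := mem_of_mem_nhds hU
  refine (intervalIntegral.hasDerivAt_integral_of_dominated_loc_of_deriv_le
    (F := f) (F' := f') (bound := fun _ => C) (Metric.closedBall_mem_nhds x₀ hε)
    ?_ (hf x₀ hx₀).intervalIntegrable ?_ ?_ intervalIntegrable_const ?_).2
  · filter_upwards [hU] with x hx using hmeas _ (hf x hx)
  · refine hmeas _ ?_
    exact hf'.comp (f := fun θ => (x₀, θ)) (by fun_prop) fun θ hθ => ⟨hx₀, hθ⟩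
  · exact .of_forall fun θ hθ x hx => hC (x, θ) ⟨hx, Set.uIoc_subset_uIcc hθ⟩
  · exact .of_forall fun θ hθ x hx => hd x (hK hx) θ (Set.uIoc_subset_uIcc hθ)

theorem trace_circleIntM {m : ℕ} {F : ℝ → Matrix (Fin m) (Fin m) ℂ}
    (hF : ContinuousOn F (Set.uIcc (-Real.pi) Real.pi)) :
    (circleIntM F).trace
      = (2 * (Real.pi : ℂ))⁻¹ * ∫ θ in (-Real.pi)..Real.pi, (F θ).trace := by
  simp only [circleIntM, Matrix.trace, Matrix.diag_apply, Matrix.of_apply]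
  rw [← Finset.mul_sum, intervalIntegral.integral_finsetSum]
  exact fun i _ => ContinuousOn.intervalIntegrable
    ((continuous_id.matrix_elem i i).comp_continuousOn hF)

section MatrixCalculus

open scoped Matrix.Norms.Operator

variable {m : Type*} [Fintype m] [DecidableEq m]

theorem Matrix.hasDerivAt_inv_line (Q P : Matrix m m ℂ) (t : ℝ)
    (h : (Q + t • P).det ≠ 0) :
    HasDerivAt (fun t : ℝ => (Q + t • P)⁻¹) (-((Q + t • P)⁻¹ * P * (Q + t • P)⁻¹)) t := by
  have hl : HasDerivAt (fun t : ℝ => Q + t • P) P t := by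
    exact (((hasDerivAt_id t).smul_const P).const_add Q).congr_deriv (one_smul ℝ P)
  obtain ⟨u, hu⟩ := (Matrix.isUnit_iff_isUnit_det _).2 h.isUnit
  have hr : HasFDerivAt Ring.inverse (-ContinuousLinearMap.mulLeftRight ℝ (Matrix m m ℂ) ↑u⁻¹ ↑u⁻¹)
      (Q + t • P) := hu ▸ hasFDerivAt_ringInverse u
  have hc := hr.comp_hasDerivAt t hl
  have hui : (↑u⁻¹ : Matrix m m ℂ) = (Q + t • P)⁻¹ := by
    rw [← hu, Matrix.coe_units_inv]
  simp only [Function.comp_def, hui, ← Matrix.nonsing_inv_eq_ringInverse] at hc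
  exact hc

theorem HasDerivAt.matrix_trace_mul_const {f : ℝ → Matrix m m ℂ} {f' : Matrix m m ℂ} {t : ℝ}
    (hf : HasDerivAt f f' t) (M : Matrix m m ℂ) :
    HasDerivAt (fun t => (f t * M).trace) (f' * M).trace t :=
  ((Matrix.traceLinearMap m ℝ ℂ).toContinuousLinearMap.hasFDerivAt).comp_hasDerivAt t
    (hf.mul_const M)

theorem Matrix.hasDerivAt_trace_inv_line (Q P Ψ : Matrix m m ℂ) (t : ℝ)
    (h : (Q + t • P).det ≠ 0) :
    HasDerivAt (fun t : ℝ => ((Q + t • P)⁻¹ * Ψ).trace)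
      (-((Q + t • P)⁻¹ * P * (Q + t • P)⁻¹) * Ψ).trace t :=
  (Matrix.hasDerivAt_inv_line Q P t h).matrix_trace_mul_const Ψ

theorem Matrix.hasDerivAt_trace_inv_mul_inv_line (Q P R Ψ : Matrix m m ℂ) (t : ℝ)
    (h : (Q + t • P).det ≠ 0) :
    HasDerivAt (fun t : ℝ => (-((Q + t • P)⁻¹ * R * (Q + t • P)⁻¹) * Ψ).trace)
      ((((Q + t • P)⁻¹ * P * (Q + t • P)⁻¹ * R * (Q + t • P)⁻¹
        + (Q + t • P)⁻¹ * R * (Q + t • P)⁻¹ * P * (Q + t • P)⁻¹) * Ψ).trace) t := by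
  have hi := Matrix.hasDerivAt_inv_line Q P t h
  refine (((hi.mul_const R).mul hi).neg.congr_deriv ?_).matrix_trace_mul_const Ψ
  noncomm_ring

end MatrixCalculus

theorem Qfun_add_smul {n m : ℕ} (A : Matrix (Fin n) (Fin n) ℂ) (B : Matrix (Fin n) (Fin m) ℂ)
    (Λ Δ : Matrix (Fin n) (Fin n) ℂ) (t θ : ℝ) :
    Qfun A B (Λ + t • Δ) θ = Qfun A B Λ θ + t • ((Gfun A B θ)ᴴ * Δ * Gfun A B θ) := by
  simp [Qfun, Matrix.mul_add, Matrix.add_mul, add_assoc]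

theorem continuous_Qfun {n m : ℕ} {A : Matrix (Fin n) (Fin n) ℂ} {B : Matrix (Fin n) (Fin m) ℂ}
    (hG : Continuous (Gfun A B)) (Λ : Matrix (Fin n) (Fin n) ℂ) : Continuous (Qfun A B Λ) :=
  continuous_const.add
    ((hG.matrix_conjTranspose.matrix_mul continuous_const).matrix_mul hG)

theorem continuous_Qfun_line {n m : ℕ} {A : Matrix (Fin n) (Fin n) ℂ}
    {B : Matrix (Fin n) (Fin m) ℂ} (hG : Continuous (Gfun A B))
    (Λ Δ : Matrix (Fin n) (Fin n) ℂ) :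
    Continuous fun p : ℝ × ℝ => Qfun A B (Λ + p.1 • Δ) p.2 := by
  have hG' := hG.comp (continuous_snd (X := ℝ) (Y := ℝ))
  exact continuous_const.add ((hG'.matrix_conjTranspose.matrix_mul
    (by fun_prop : Continuous fun p : ℝ × ℝ => Λ + p.1 • Δ)).matrix_mul hG')

theorem exists_isOpen_det_Qfun_line_ne_zero {n m : ℕ} {A : Matrix (Fin n) (Fin n) ℂ}
    {B : Matrix (Fin n) (Fin m) ℂ} (hG : Continuous (Gfun A B))
    {Λ : Matrix (Fin n) (Fin n) ℂ} (Δ : Matrix (Fin n) (Fin n) ℂ) {K : Set ℝ} (hK : IsCompact K)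
    (hQ : ∀ θ ∈ K, (Qfun A B Λ θ).det ≠ 0) :
    ∃ U : Set ℝ, IsOpen U ∧ 0 ∈ U ∧ ∀ t ∈ U, ∀ θ ∈ K, (Qfun A B (Λ + t • Δ) θ).det ≠ 0 := by
  have hopen : IsOpen {p : ℝ × ℝ | (Qfun A B (Λ + p.1 • Δ) p.2).det ≠ 0} :=
    isOpen_ne_fun (continuous_Qfun_line hG Λ Δ).matrix_det continuous_const
  have hsub : {(0 : ℝ)} ×ˢ K ⊆ {p : ℝ × ℝ | (Qfun A B (Λ + p.1 • Δ) p.2).det ≠ 0} := by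
    intro p hp
    have hp₁ : p.1 = 0 := hp.1
    rw [Set.mem_ofPred_eq, hp₁, zero_smul, add_zero]
    exact hQ p.2 hp.2
  obtain ⟨U, V, hU, -, h0, hKV, hUV⟩ := generalized_tube_lemma isCompact_singleton hK hopen hsub
  refine ⟨U, hU, h0 (Set.mem_singleton 0), fun t ht θ hθ => ?_⟩
  simpa only [Set.mem_ofPred_eq] using hUV (Set.mk_mem_prod ht (hKV hθ))

/-- The first directional derivative of `Jfun`, before simplification of the trace. -/
theorem hasDerivAt_Jfun_line {n m : ℕ} {A : Matrix (Fin n) (Fin n) ℂ}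
    {B : Matrix (Fin n) (Fin m) ℂ} (hG : Continuous (Gfun A B))
    {Ψ : ℝ → Matrix (Fin m) (Fin m) ℂ} (hΨ : Continuous Ψ)
    {Λ : Matrix (Fin n) (Fin n) ℂ} (Δ : Matrix (Fin n) (Fin n) ℂ)
    (hQ : ∀ θ ∈ Set.uIcc (-Real.pi) Real.pi, (Qfun A B Λ θ).det ≠ 0) :
    HasDerivAt (fun t : ℝ => Jfun A B Ψ (Λ + t • Δ))
      ((2 * (Real.pi : ℂ))⁻¹ * (∫ θ in (-Real.pi)..Real.pi,
        (-((Qfun A B Λ θ)⁻¹ * ((Gfun A B θ)ᴴ * Δ * Gfun A B θ) * (Qfun A B Λ θ)⁻¹) * Ψ θ).trace)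
        + Δ.trace).re 0 := by
  obtain ⟨U, hUo, h0, hU⟩ := exists_isOpen_det_Qfun_line_ne_zero hG Δ isCompact_uIcc hQ
  have hUn : U ∈ nhds (0 : ℝ) := hUo.mem_nhds h0
  have hinv : ContinuousOn (fun p : ℝ × ℝ => (Qfun A B (Λ + p.1 • Δ) p.2)⁻¹)
      (U ×ˢ Set.uIcc (-Real.pi) Real.pi) :=
    (continuous_Qfun_line hG Λ Δ).continuousOn.matrix_inv fun p hp => hU p.1 hp.1 p.2 hp.2
  have hP : Continuous fun p : ℝ × ℝ => (Gfun A B p.2)ᴴ * Δ * Gfun A B p.2 :=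
    ((hG.matrix_conjTranspose.matrix_mul continuous_const).matrix_mul hG).comp continuous_snd
  have hinv₁ : ∀ t ∈ U, ContinuousOn (fun θ => (Qfun A B (Λ + t • Δ) θ)⁻¹ * Ψ θ)
      (Set.uIcc (-Real.pi) Real.pi) := fun t ht =>
    ((continuous_Qfun hG _).continuousOn.matrix_inv (hU t ht)).mul hΨ.continuousOn
  have hint := hasDerivAt_intervalIntegral_of_continuousOn
    (f := fun t θ => ((Qfun A B (Λ + t • Δ) θ)⁻¹ * Ψ θ).trace)
    (f' := fun t θ => (-((Qfun A B (Λ + t • Δ) θ)⁻¹ * ((Gfun A B θ)ᴴ * Δ * Gfun A B θ)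
      * (Qfun A B (Λ + t • Δ) θ)⁻¹) * Ψ θ).trace)
    (a := -Real.pi) (b := Real.pi) hUn
    (fun t ht => (continuous_id.matrix_trace).comp_continuousOn (hinv₁ t ht))
    ((continuous_id.matrix_trace).comp_continuousOn
      (((hinv.mul hP.continuousOn).mul hinv).neg.mul (hΨ.comp continuous_snd).continuousOn))
    (fun t ht θ hθ => by
      have h := hU t ht θ hθ
      simp only [Qfun_add_smul] at h ⊢
      exact Matrix.hasDerivAt_trace_inv_line _ _ _ t h)
  have htr : HasDerivAt (fun t : ℝ => (Λ + t • Δ).trace) Δ.trace 0 := by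
    simpa using ((hasDerivAt_id (0 : ℝ)).smul_const Δ.trace).const_add Λ.trace
  have hsum := Complex.reCLM.hasFDerivAt.comp_hasDerivAt (0 : ℝ)
    ((hint.const_mul (2 * (Real.pi : ℂ))⁻¹).add htr)
  simp only [zero_smul, add_zero] at hsum
  refine hsum.congr_of_eventuallyEq ?_
  filter_upwards [hUn] with t ht
  simp [Jfun, trace_circleIntM (hinv₁ t ht)]

theorem stmt8 {n m : ℕ} (A : Matrix (Fin n) (Fin n) ℂ) (B : Matrix (Fin n) (Fin m) ℂ)
    (hA : ∀ z ∈ spectrum ℂ A, ‖z‖ < 1) (hB : B.rank = m) (hAB : IsReachable A B)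
    (Ψ : ℝ → Matrix (Fin m) (Fin m) ℂ) (hΨc : Continuous Ψ)
    (hΨper : Function.Periodic Ψ (2 * Real.pi)) (hΨpd : ∀ θ : ℝ, (Ψ θ).PosDef)
    (Λ : Matrix (Fin n) (Fin n) ℂ) (hΛ : Λ.IsHermitian)
    (hQ : ∀ θ : ℝ, (Qfun A B Λ θ).PosDef)
    (δΛ₁ δΛ₂ : Matrix (Fin n) (Fin n) ℂ)
    (hδΛ₁ : δΛ₁.IsHermitian) (hδΛ₂ : δΛ₂.IsHermitian) :
    HasDerivAt
      (fun s : ℝ => deriv (fun t : ℝ => Jfun A B Ψ (Λ + s • δΛ₂ + t • δΛ₁)) 0)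
      (((circleIntM fun θ =>
            Ψ θ * (Qfun A B Λ θ)⁻¹ * (Gfun A B θ)ᴴ * δΛ₂ * Gfun A B θ *
              (Qfun A B Λ θ)⁻¹ * (Gfun A B θ)ᴴ * δΛ₁ * Gfun A B θ * (Qfun A B Λ θ)⁻¹).trace
        + (circleIntM fun θ =>
            Ψ θ * (Qfun A B Λ θ)⁻¹ * (Gfun A B θ)ᴴ * δΛ₁ * Gfun A B θ *
              (Qfun A B Λ θ)⁻¹ * (Gfun A B θ)ᴴ * δΛ₂ * Gfun A B θ * (Qfun A B Λ θ)⁻¹).trace).re)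
      0 := by
  have hG := continuous_Gfun A B hA
  have hdet : ∀ θ ∈ Set.uIcc (-Real.pi) Real.pi, (Qfun A B Λ θ).det ≠ 0 :=
    fun θ _ => (hQ θ).det_pos.ne'
  obtain ⟨U, hUo, h0, hU⟩ := exists_isOpen_det_Qfun_line_ne_zero hG δΛ₂ isCompact_uIcc hdet
  have hUn : U ∈ nhds (0 : ℝ) := hUo.mem_nhds h0
  have hinv : ContinuousOn (fun p : ℝ × ℝ => (Qfun A B (Λ + p.1 • δΛ₂) p.2)⁻¹)
      (U ×ˢ Set.uIcc (-Real.pi) Real.pi) :=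
    (continuous_Qfun_line hG Λ δΛ₂).continuousOn.matrix_inv fun p hp => hU p.1 hp.1 p.2 hp.2
  have hP : ∀ Δ : Matrix (Fin n) (Fin n) ℂ,
      Continuous fun θ : ℝ => (Gfun A B θ)ᴴ * Δ * Gfun A B θ := fun Δ =>
    (hG.matrix_conjTranspose.matrix_mul continuous_const).matrix_mul hG
  have hP' : ∀ Δ : Matrix (Fin n) (Fin n) ℂ, ContinuousOn
      (fun p : ℝ × ℝ => (Gfun A B p.2)ᴴ * Δ * Gfun A B p.2)
      (U ×ˢ Set.uIcc (-Real.pi) Real.pi) := fun Δ =>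
    ((hP Δ).comp continuous_snd).continuousOn
  have hinv₁ : ∀ t ∈ U, ContinuousOn (fun θ => (Qfun A B (Λ + t • δΛ₂) θ)⁻¹)
      (Set.uIcc (-Real.pi) Real.pi) := fun t ht =>
    (continuous_Qfun hG _).continuousOn.matrix_inv (hU t ht)
  have hint := hasDerivAt_intervalIntegral_of_continuousOn
    (f := fun t θ => (-((Qfun A B (Λ + t • δΛ₂) θ)⁻¹ * ((Gfun A B θ)ᴴ * δΛ₁ * Gfun A B θ)
      * (Qfun A B (Λ + t • δΛ₂) θ)⁻¹) * Ψ θ).trace)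
    (f' := fun t θ => (((Qfun A B (Λ + t • δΛ₂) θ)⁻¹ * ((Gfun A B θ)ᴴ * δΛ₂ * Gfun A B θ)
        * (Qfun A B (Λ + t • δΛ₂) θ)⁻¹ * ((Gfun A B θ)ᴴ * δΛ₁ * Gfun A B θ)
        * (Qfun A B (Λ + t • δΛ₂) θ)⁻¹
      + (Qfun A B (Λ + t • δΛ₂) θ)⁻¹ * ((Gfun A B θ)ᴴ * δΛ₁ * Gfun A B θ)
        * (Qfun A B (Λ + t • δΛ₂) θ)⁻¹ * ((Gfun A B θ)ᴴ * δΛ₂ * Gfun A B θ)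
        * (Qfun A B (Λ + t • δΛ₂) θ)⁻¹) * Ψ θ).trace)
    (a := -Real.pi) (b := Real.pi) hUn
    (fun t ht => (continuous_id.matrix_trace).comp_continuousOn
      ((((hinv₁ t ht).mul (hP δΛ₁).continuousOn).mul (hinv₁ t ht)).neg.mul hΨc.continuousOn))
    ((continuous_id.matrix_trace).comp_continuousOn
      ((((((hinv.mul (hP' δΛ₂)).mul hinv).mul (hP' δΛ₁)).mul hinv).add
        ((((hinv.mul (hP' δΛ₁)).mul hinv).mul (hP' δΛ₂)).mul hinv)).mul
          (hΨc.comp continuous_snd).continuousOn))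
    (fun t ht θ hθ => by
      have h := hU t ht θ hθ
      simp only [Qfun_add_smul] at h ⊢
      exact Matrix.hasDerivAt_trace_inv_mul_inv_line _ _ _ _ t h)
  have hsum := Complex.reCLM.hasFDerivAt.comp_hasDerivAt (0 : ℝ)
    ((hint.const_mul (2 * (Real.pi : ℂ))⁻¹).add_const δΛ₁.trace)
  have hinv₀ : ContinuousOn (fun θ => (Qfun A B Λ θ)⁻¹) (Set.uIcc (-Real.pi) Real.pi) :=
    (continuous_Qfun hG _).continuousOn.matrix_inv hdet
  have hcont : ∀ Δ₁ Δ₂ : Matrix (Fin n) (Fin n) ℂ, ContinuousOn (fun θ =>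
      Ψ θ * (Qfun A B Λ θ)⁻¹ * (Gfun A B θ)ᴴ * Δ₁ * Gfun A B θ *
        (Qfun A B Λ θ)⁻¹ * (Gfun A B θ)ᴴ * Δ₂ * Gfun A B θ * (Qfun A B Λ θ)⁻¹)
      (Set.uIcc (-Real.pi) Real.pi) := fun Δ₁ Δ₂ => by
    have h := ((((hΨc.continuousOn.mul hinv₀).mul (hP Δ₁).continuousOn).mul hinv₀).mul
      (hP Δ₂).continuousOn).mul hinv₀
    exact h.congr fun θ _ => by simp [Matrix.mul_assoc]
  have hintegrable : ∀ Δ₁ Δ₂ : Matrix (Fin n) (Fin n) ℂ, IntervalIntegrable (fun θ =>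
      (Ψ θ * (Qfun A B Λ θ)⁻¹ * (Gfun A B θ)ᴴ * Δ₁ * Gfun A B θ *
        (Qfun A B Λ θ)⁻¹ * (Gfun A B θ)ᴴ * Δ₂ * Gfun A B θ * (Qfun A B Λ θ)⁻¹).trace)
      volume (-Real.pi) Real.pi := fun Δ₁ Δ₂ =>
    (continuous_id.matrix_trace.comp_continuousOn (hcont Δ₁ Δ₂)).intervalIntegrable
  have hderiv := hsum.congr_of_eventuallyEq (f₁ := fun s : ℝ =>
      deriv (fun t : ℝ => Jfun A B Ψ (Λ + s • δΛ₂ + t • δΛ₁)) 0) (by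
    filter_upwards [hUn] with s hs
    exact (hasDerivAt_Jfun_line hG hΨc δΛ₁ (hU s hs)).deriv)
  refine hderiv.congr_deriv ?_
  rw [trace_circleIntM (hcont δΛ₂ δΛ₁), trace_circleIntM (hcont δΛ₁ δΛ₂), ← mul_add,
    ← intervalIntegral.integral_add (hintegrable δΛ₂ δΛ₁) (hintegrable δΛ₁ δΛ₂)]
  simp only [zero_smul, add_zero, Complex.reCLM_apply]
  congr 3
  funext θ
  rw [Matrix.trace_mul_comm, Matrix.mul_add, Matrix.trace_add]
  simp only [← Matrix.mul_assoc]
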